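/- arXiv:2401.15822 — 5 statements merged into one kernel-verified Lean document; each statement's English description precedes it below -/
import Mathlib

section
/- Let G be a group and n ≥ 2. Two generating n-tuples a and b of G are Nielsen equivalent if and only if b can be obtained from a by a finite sequence of the four elementary Nielsen transformations: (1) swapping the first two entries, (2) cyclically permuting the entries, (3) replacing the first entry by its inverse, and (4) replacing the first entry by the product of the first two entries. -/
/-- A generating tuple of a group `G`: a function `Fin n → G` whose range generates `G`. -/
def IsGeneratingTuple {G : Type*} [Group G] {n : ℕ} (a : Fin n → G) : Prop :=
  Subgroup.closure (Set.range a) = ⊤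

/-- Two `n`-tuples `a b : Fin n → G` are Nielsen equivalent if there exist a basis `y` of the
free group `F_n = FreeGroup (Fin n)` and a homomorphism `φ : F_n →* G` with `φ (x i) = a i`
and `φ (y i) = b i`, where `x` is the standard basis. -/
def NielsenEquiv {G : Type*} [Group G] {n : ℕ} (a b : Fin n → G) : Prop :=
  ∃ (y : FreeGroupBasis (Fin n) (FreeGroup (Fin n))) (φ : FreeGroup (Fin n) →* G),
    (∀ i, φ (FreeGroup.of i) = a i) ∧ (∀ i, φ (y i) = b i)

/-- One elementary Nielsen transformation: swap the first two entries, cyclically permute the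
entries, invert the first entry, or replace the first entry by the product of the first two. -/
def ElementaryNielsenStep {G : Type*} [Group G] {n : ℕ} (a b : Fin (n + 2) → G) : Prop :=
  b = a ∘ Equiv.swap 0 1 ∨
  b = (fun i => a (i + 1)) ∨
  b = Function.update a 0 (a 0)⁻¹ ∨
  b = Function.update a 0 (a 0 * a 1)

namespace NielsenAux

open FreeGroup

/-- Length of the longest common prefix. -/
def lcp {β : Type*} [DecidableEq β] : List β → List β → ℕ
  | a :: l, b :: m => if a = b then lcp l m + 1 else 0
  | [], _ => 0
  | _ :: _, [] => 0

section lcp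
variable {β : Type*} [DecidableEq β]

theorem lcp_comm (l m : List β) : lcp l m = lcp m l := by
  induction l generalizing m with
  | nil => cases m <;> simp [lcp]
  | cons a l ih =>
    cases m with
    | nil => simp [lcp]
    | cons b m =>
      simp only [lcp, ih m, eq_comm]

theorem lcp_le_left (l m : List β) : lcp l m ≤ l.length := by
  induction l generalizing m with
  | nil => cases m <;> simp [lcp]
  | cons a l ih =>
    cases m with
    | nil => simp [lcp]
    | cons b m =>
      simp only [lcp, List.length_cons]
      have := ih m
      split_ifs <;> omega

theorem lcp_le_right (l m : List β) : lcp l m ≤ m.length := by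
  rw [lcp_comm]; exact lcp_le_left _ _

theorem lcp_ultra (l m k : List β) : min (lcp l m) (lcp m k) ≤ lcp l k := by
  induction l generalizing m k with
  | nil => cases m <;> simp [lcp]
  | cons a l ih =>
    cases m with
    | nil => simp [lcp]
    | cons b m =>
      cases k with
      | nil => simp [lcp]
      | cons c k =>
        simp only [lcp]
        have := ih m k
        split_ifs <;> simp_all

theorem lcp_isosceles {l m k : List β} (h : lcp k m < lcp l m) : lcp k l = lcp k m := by
  have h1 := lcp_ultra k m l
  have h2 := lcp_ultra k l m
  rw [lcp_comm m l] at h1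
  omega

theorem take_lcp (l m : List β) : l.take (lcp l m) = m.take (lcp l m) := by
  induction l generalizing m with
  | nil => cases m <;> simp [lcp]
  | cons a l ih =>
    cases m with
    | nil => simp [lcp]
    | cons b m =>
      simp only [lcp]
      split_ifs with h
      · simp [h, ih m]
      · simp

theorem le_lcp (l m : List β) (k : ℕ) (h : l.take k = m.take k) (hk : k ≤ l.length)
    (hk' : k ≤ m.length) : k ≤ lcp l m := by
  induction l generalizing m k with
  | nil => simp at hk; omega
  | cons a l ih =>
    cases m with
    | nil => simp at hk'; omega
    | cons b m =>
      cases k with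
      | zero => omega
      | succ k =>
        simp at h hk hk'
        have := ih m k h.2 hk hk'
        simp [lcp, h.1, this]

theorem drop_lcp_head (l m : List β) (a : β) (ha : a ∈ (l.drop (lcp l m)).head?)
    (hb : a ∈ (m.drop (lcp l m)).head?) : False := by
  induction l generalizing m with
  | nil => simp at ha
  | cons c l ih =>
    cases m with
    | nil => simp at hb
    | cons b m =>
      simp only [lcp] at ha hb
      split_ifs at ha hb with h
      · exact ih m (by simpa using ha) (by simpa using hb)
      · simp at ha hb
        exact h (ha.trans hb.symm)

end lcp

section words
variable {α : Type*} [DecidableEq α]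

/-- Common prefix length of two elements of the free group. -/
def gp (g h : FreeGroup α) : ℕ := lcp g.toWord h.toWord

theorem isReduced_invRev {w : List (α × Bool)} (h : IsReduced w) : IsReduced (invRev w) := by
  rw [isReduced_iff_reduce_eq] at h ⊢
  rw [reduce_invRev, h]

theorem toWord_inv_mul (g h : FreeGroup α) :
    (g⁻¹ * h).toWord = invRev (g.toWord.drop (gp g h)) ++ h.toWord.drop (gp g h) := by
  have e : g⁻¹ * h = mk (invRev (g.toWord.drop (gp g h)) ++ h.toWord.drop (gp g h)) := by
    have hg : g = mk (g.toWord.take (gp g h)) * mk (g.toWord.drop (gp g h)) := by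
      rw [mul_mk, List.take_append_drop, mk_toWord]
    have hh : h = mk (g.toWord.take (gp g h)) * mk (h.toWord.drop (gp g h)) := by
      rw [gp, take_lcp, mul_mk, List.take_append_drop, mk_toWord]
    rw [← mul_mk, ← inv_mk]
    generalize gp g h = k at *
    generalize mk (g.toWord.take k) = p at *
    generalize mk (g.toWord.drop k) = q at *
    generalize mk (h.toWord.drop k) = r at *
    rw [hg, hh]; group
  rw [e, toWord_mk]
  apply IsReduced.reduce_eq
  have r1 : IsReduced (g.toWord.drop (gp g h)) :=
    isReduced_toWord.infix (List.drop_suffix _ _).isInfix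
  have r2 : IsReduced (h.toWord.drop (gp g h)) :=
    isReduced_toWord.infix (List.drop_suffix _ _).isInfix
  have r3 := isReduced_invRev r1
  unfold FreeGroup.IsReduced at r2 r3 ⊢
  rw [List.isChain_append]
  refine ⟨r3, r2, ?_⟩
  intro x hx y hy hxy
  by_contra hne
  have hx' : y ∈ (g.toWord.drop (gp g h)).head? := by
    simp only [invRev, List.getLast?_reverse, List.head?_map] at hx
    obtain ⟨z, hz, rfl⟩ := Option.mem_map.1 hx
    have : y = z := by
      rcases y with ⟨y1, y2⟩
      rcases z with ⟨z1, z2⟩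
      simp at hxy hne
      simp [hxy]
      cases y2 <;> cases z2 <;> simp_all
    rwa [this]
  exact drop_lcp_head _ _ y hx' hy

theorem gp_comm (g h : FreeGroup α) : gp g h = gp h g := lcp_comm _ _

theorem norm_inv_mul (g h : FreeGroup α) : (g⁻¹ * h).norm + 2 * gp g h = g.norm + h.norm := by
  have h1 := lcp_le_left g.toWord h.toWord
  have h2 := lcp_le_right g.toWord h.toWord
  rw [FreeGroup.norm, toWord_inv_mul, FreeGroup.norm, FreeGroup.norm]
  simp only [List.length_append, invRev_length, List.length_drop]
  unfold gp
  omega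

theorem gp_inv_self {g : FreeGroup α} (hg : g ≠ 1) : 2 * gp g g⁻¹ < g.norm := by
  by_contra hcon
  have hL : 0 < g.toWord.length := by
    rw [List.length_pos_iff]; simpa using hg
  have ht := take_lcp g.toWord (g⁻¹).toWord
  change g.toWord.take (gp g g⁻¹) = (g⁻¹).toWord.take (gp g g⁻¹) at ht
  unfold FreeGroup.norm at hcon
  have hred : IsReduced g.toWord := isReduced_toWord
  rw [toWord_inv] at ht
  have hk : gp g g⁻¹ ≤ g.toWord.length := lcp_le_left _ _
  generalize gp g g⁻¹ = k at *
  generalize g.toWord = w at *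
  have key : ∀ i (hi : i < k), w[i]'(by omega) =
      ((w[w.length - 1 - i]'(by omega)).1, !(w[w.length - 1 - i]'(by omega)).2) := by
    intro i hi
    have : (w.take k)[i]'(by simp; omega) = ((invRev w).take k)[i]'(by simp; omega) := by
      simp only [ht]
    simpa [invRev] using this
  rcases Nat.even_or_odd' w.length with ⟨m, hm | hm⟩
  · have := key (m - 1) (by omega)
    have e : w.length - 1 - (m - 1) = m := by omega
    simp only [e] at this
    unfold FreeGroup.IsReduced at hred
    rw [List.isChain_iff_getElem] at hred
    have h2 := hred (m - 1) (by omega)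
    have e2 : m - 1 + 1 = m := by omega
    simp only [e2] at h2
    rw [this] at h2
    simp at h2
  · have := key m (by omega)
    have e : w.length - 1 - m = m := by omega
    simp only [e] at this
    have := congrArg Prod.snd this
    simp at this

theorem toWord_mul_half {t r : FreeGroup α} {h : ℕ} (ht : t.norm = 2 * h) (hg : gp t⁻¹ r = h) :
    (t * r).toWord = t.toWord.take h ++ r.toWord.drop h ∧
      (t⁻¹).toWord.take h = r.toWord.take h := by
  constructor
  · have := toWord_inv_mul t⁻¹ r
    rw [inv_inv, hg, toWord_inv] at this
    rw [this]
    congr 1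
    conv_lhs => rw [← List.take_append_drop h t.toWord, invRev_append]
    unfold FreeGroup.norm at ht
    rw [List.drop_left' (by simp; omega), invRev_invRev]
  · rw [← hg]; exact take_lcp _ _

end words

section enc
variable {N : ℕ}

/-- Numerical encoding of words. -/
def enc : List (Fin N × Bool) → ℕ
  | [] => 0
  | a :: l => (2 * a.1.val + a.2.toNat) + 2 * N * enc l

theorem enc_append (l m : List (Fin N × Bool)) :
    enc (l ++ m) = enc l + (2 * N) ^ l.length * enc m := by
  induction l with
  | nil => simp [enc]
  | cons a l ih => simp [enc, ih]; ring

theorem enc_inj (l m : List (Fin N × Bool)) (hl : l.length = m.length) (h : enc l = enc m) :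
    l = m := by
  induction l generalizing m with
  | nil => simpa [eq_comm] using hl
  | cons a l ih =>
    cases m with
    | nil => simp at hl
    | cons b m =>
      simp only [enc] at h
      have ha : 2 * a.1.val + a.2.toNat < 2 * N := by
        have := a.1.2; have := a.2.toNat_lt; omega
      have hb : 2 * b.1.val + b.2.toNat < 2 * N := by
        have := b.1.2; have := b.2.toNat_lt; omega
      have h1 := congrArg (· % (2 * N)) h
      have h2 := congrArg (· / (2 * N)) h
      have hN : 0 < 2 * N := by omega
      simp only [Nat.add_mul_mod_self_left, Nat.mod_eq_of_lt ha, Nat.mod_eq_of_lt hb] at h1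
      simp only [Nat.add_mul_div_left _ _ hN, Nat.div_eq_of_lt ha, Nat.div_eq_of_lt hb,
        zero_add] at h2
      rw [ih m (by simpa using hl) h2]
      congr 1
      have := a.2.toNat_lt; have := b.2.toNat_lt
      rcases a with ⟨a1, a2⟩
      rcases b with ⟨b1, b2⟩
      simp only at *
      have e1 : a1 = b1 := Fin.ext (by omega)
      have e2 : a2.toNat = b2.toNat := by omega
      rw [e1]
      cases a2 <;> cases b2 <;> simp_all

/-- Tie-breaking weight. -/
def tau (g : FreeGroup (Fin N)) : ℕ :=
  enc (g.toWord.take ((g.norm + 1) / 2)) + enc ((g⁻¹).toWord.take ((g.norm + 1) / 2))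

theorem tau_inv (g : FreeGroup (Fin N)) : tau g⁻¹ = tau g := by
  simp only [tau, norm_inv_eq, inv_inv, add_comm]

theorem tau_lt {t r : FreeGroup (Fin N)} {h : ℕ} (ht : t.norm = 2 * h) (hg : gp t⁻¹ r = h)
    (hr : 2 * h ≤ r.norm) (hlt : enc (t.toWord.take h) < enc ((t⁻¹).toWord.take h)) :
    (t * r).norm = r.norm ∧ tau (t * r) < tau r := by
  obtain ⟨h1, h2⟩ := toWord_mul_half ht hg
  have hn : (t * r).norm = r.norm := by
    unfold FreeGroup.norm at *
    rw [h1]; simp; omega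
  refine ⟨hn, ?_⟩
  unfold tau
  rw [hn, toWord_inv, toWord_inv, h1]
  rw [h2] at hlt
  set m := (r.norm + 1) / 2 with hm
  unfold FreeGroup.norm at hm hr ht
  have hp : (t.toWord.take h).length = h := by simp; omega
  have hq : (r.toWord.take h).length = h := by simp; omega
  have e0 : r.toWord = r.toWord.take h ++ r.toWord.drop h := (List.take_append_drop _ _).symm
  have e1 : enc ((t.toWord.take h ++ r.toWord.drop h).take m) < enc (r.toWord.take m) := by
    conv_rhs => rw [e0]
    rw [List.take_append, List.take_append, hp, hq,
      List.take_of_length_le (l := t.toWord.take h) (by omega),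
      List.take_of_length_le (l := r.toWord.take h) (by omega), enc_append, enc_append, hp, hq]
    omega
  have e2 : (invRev (t.toWord.take h ++ r.toWord.drop h)).take m = (invRev r.toWord).take m := by
    conv_rhs => rw [e0]
    rw [invRev_append, invRev_append, List.take_append_of_le_length (by simp; omega),
      List.take_append_of_le_length (by simp; omega)]
  rw [e2]
  omega

end enc

section reach
variable {G : Type*} [Group G] {n : ℕ}

/-- Reachability by elementary steps. -/
abbrev Reach (a b : Fin (n + 2) → G) : Prop := Relation.ReflTransGen ElementaryNielsenStep a b

theorem reach_perm (π : Equiv.Perm (Fin (n + 2))) : ∀ a : Fin (n + 2) → G, Reach a (a ∘ π) := by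
  have h0 : finRotate (n + 2) 0 = 1 := by simp
  have hπ : π ∈ Submonoid.closure
      ({finRotate (n + 2), Equiv.swap 0 (finRotate (n + 2) 0)} : Set (Equiv.Perm (Fin (n + 2)))) := by
    rw [← Subgroup.closure_toSubmonoid_of_finite,
      Equiv.Perm.closure_cycle_adjacent_swap isCycle_finRotate support_finRotate 0]
    trivial
  induction hπ using Submonoid.closure_induction with
  | mem x hx =>
    intro a
    apply Relation.ReflTransGen.single
    rcases hx with rfl | hx
    · right; left
      funext i
      simp
    · left
      rw [Set.mem_singleton_iff] at hx
      rw [hx, h0]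
  | one => intro a; exact Relation.ReflTransGen.refl
  | mul x y _ _ hx hy =>
    intro a
    exact (hx a).trans (hy (a ∘ x))

/-- A move at positions determined by a permutation. -/
theorem reach_conj (π : Equiv.Perm (Fin (n + 2))) (a : Fin (n + 2) → G) (g : G)
    (h : Reach (a ∘ π) (Function.update (a ∘ π) 0 g)) : Reach a (Function.update a (π 0) g) := by
  have h1 := (reach_perm π a).trans h
  have h2 := h1.trans (reach_perm π⁻¹ _)
  convert h2 using 1
  funext i
  simp only [Function.comp, Function.update_apply]
  by_cases hi : i = π 0
  · subst hi; simp
  · have : (Equiv.symm π) i ≠ 0 := fun h => hi (by rw [← h]; simp)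
    simp [hi, this]

theorem reach_inv (a : Fin (n + 2) → G) (i : Fin (n + 2)) :
    Reach a (Function.update a i (a i)⁻¹) := by
  have := reach_conj (Equiv.swap 0 i) a (a i)⁻¹ (Relation.ReflTransGen.single (by
    right; right; left; simp))
  simpa using this

theorem exists_perm {i j : Fin (n + 2)} (h : i ≠ j) :
    ∃ π : Equiv.Perm (Fin (n + 2)), π 0 = i ∧ π 1 = j := by
  refine ⟨Equiv.swap (Equiv.swap 0 i 1) j * Equiv.swap 0 i, ?_, ?_⟩
  · simp only [Equiv.Perm.mul_apply, Equiv.swap_apply_left]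
    apply Equiv.swap_apply_of_ne_of_ne _ h
    intro hh
    have : Equiv.swap 0 i 0 = Equiv.swap 0 i 1 := by rw [← hh]; simp
    simpa using (Equiv.swap 0 i).injective this
  · simp

theorem reach_mul (a : Fin (n + 2) → G) {i j : Fin (n + 2)} (h : i ≠ j) :
    Reach a (Function.update a i (a i * a j)) := by
  obtain ⟨π, rfl, rfl⟩ := exists_perm h
  exact reach_conj π a _ (Relation.ReflTransGen.single (by
    right; right; right; simp))

theorem reach_mul_inv (a : Fin (n + 2) → G) {i j : Fin (n + 2)} (h : i ≠ j) :
    Reach a (Function.update a i (a i * (a j)⁻¹)) := by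
  have h1 := reach_inv a j
  have h2 := h1.trans (reach_mul _ h)
  have h3 := h2.trans (reach_inv _ j)
  convert h3 using 1
  funext k
  simp only [Function.update_apply]
  by_cases hk : k = i
  · subst hk; simp [h]
  · by_cases hkj : k = j
    · subst hkj; simp [h.symm]
    · simp [hk, hkj]

theorem step_symm {a b : Fin (n + 2) → G} (h : ElementaryNielsenStep a b) : Reach b a := by
  rcases h with rfl | rfl | rfl | rfl
  · convert reach_perm (Equiv.swap 0 1) _ using 1
    funext i; simp
  · convert reach_perm (finRotate (n + 2))⁻¹ _ using 1
    funext i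
    have : finRotate (n + 2) ((finRotate (n + 2))⁻¹ i) = i := by simp
    rw [finRotate_apply] at this
    simp only [Function.comp, this]
  · convert reach_inv _ 0 using 1
    simp
  · convert reach_mul_inv _ (i := 0) (j := 1) (by simp) using 1
    simp

theorem reach_symm {a b : Fin (n + 2) → G} (h : Reach a b) : Reach b a := by
  induction h with
  | refl => exact Relation.ReflTransGen.refl
  | tail _ h ih => exact (step_symm h).trans ih

/-- Signed entries. -/
def sgn {N : ℕ} (a : Fin N → G) (s : Fin N × Bool) : G := if s.2 then a s.1 else (a s.1)⁻¹

/-- Opposite letter. -/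
def opp {N : ℕ} (s : Fin N × Bool) : Fin N × Bool := (s.1, !s.2)

theorem sgn_opp {N : ℕ} (a : Fin N → G) (s : Fin N × Bool) : sgn a (opp s) = (sgn a s)⁻¹ := by
  rcases s with ⟨i, _ | _⟩ <;> simp [sgn, opp]

theorem opp_opp {N : ℕ} (s : Fin N × Bool) : opp (opp s) = s := by
  simp [opp]

theorem opp_ne {N : ℕ} (s : Fin N × Bool) : opp s ≠ s := by
  intro h
  have := congrArg Prod.snd h
  simp [opp] at this

theorem eq_or_opp {N : ℕ} {s t : Fin N × Bool} (h : s.1 = t.1) : s = t ∨ s = opp t := by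
  rcases s with ⟨i, b⟩; rcases t with ⟨j, c⟩
  simp only at h; subst h
  cases b <;> cases c <;> simp [opp]

theorem reach_mul_sgn (a : Fin (n + 2) → G) {i : Fin (n + 2)} {t : Fin (n + 2) × Bool}
    (h : i ≠ t.1) : Reach a (Function.update a i (a i * sgn a t)) := by
  rcases t with ⟨j, _ | _⟩
  · exact reach_mul_inv a h
  · exact reach_mul a h

theorem reach_sgn (a : Fin (n + 2) → G) {s t : Fin (n + 2) × Bool} (h : s.1 ≠ t.1) :
    ∃ g : G, Reach a (Function.update a s.1 g) ∧ (g = sgn a t * sgn a s ∨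
      g = (sgn a t * sgn a s)⁻¹) := by
  rcases s with ⟨i, _ | _⟩
  · refine ⟨a i * sgn a (opp t), reach_mul_sgn a h, Or.inr ?_⟩
    rw [sgn_opp, mul_inv_rev]; simp [sgn]
  · refine ⟨(a i)⁻¹ * sgn a (opp t), ?_, Or.inr ?_⟩
    · have h1 := (reach_inv a i).trans (reach_mul_sgn _ (i := i) (t := opp t) h)
      convert h1 using 1
      have : t.1 ≠ i := fun h' => h h'.symm
      simp [sgn, opp, this]
    · rw [sgn_opp, mul_inv_rev]; simp [sgn]

theorem reach_map {H : Type*} [Group H] (φ : G →* H) {a b : Fin (n + 2) → G} (h : Reach a b) :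
    Reach (fun i => φ (a i)) (fun i => φ (b i)) := by
  induction h with
  | refl => exact Relation.ReflTransGen.refl
  | tail _ h ih =>
    refine ih.tail ?_
    rcases h with rfl | rfl | rfl | rfl
    · left; rfl
    · right; left; rfl
    · right; right; left
      funext i; by_cases hi : i = 0
      · subst hi; simp
      · simp [hi]
    · right; right; right
      funext i; by_cases hi : i = 0
      · subst hi; simp
      · simp [hi]

theorem closure_reach {a b : Fin (n + 2) → G} (h : Reach a b) :
    Subgroup.closure (Set.range b) ≤ Subgroup.closure (Set.range a) := by
  induction h with
  | refl => exact le_rfl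
  | @tail b c _ h ih =>
    refine le_trans ?_ ih
    rw [Subgroup.closure_le]
    have hm : ∀ i, b i ∈ Subgroup.closure (Set.range b) :=
      fun i => Subgroup.subset_closure ⟨i, rfl⟩
    rintro _ ⟨i, rfl⟩
    rcases h with rfl | rfl | rfl | rfl
    · exact hm _
    · exact hm _
    · by_cases hi : i = 0
      · subst hi; simpa using hm 0
      · simpa [hi] using hm i
    · by_cases hi : i = 0
      · subst hi; simpa using mul_mem (hm 0) (hm 1)
      · simpa [hi] using hm i

/-- invert an arbitrary set of entries -/
theorem reach_signs (s : Finset (Fin (n + 2))) (a : Fin (n + 2) → G) :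
    Reach a (fun i => if i ∈ s then (a i)⁻¹ else a i) := by
  induction s using Finset.induction_on with
  | empty => simpa using Relation.ReflTransGen.refl
  | insert j s hj ih =>
    convert ih.trans (reach_inv _ j) using 1
    funext i
    by_cases hi : i = j
    · subst hi; simp [hj]
    · simp [hi]

end reach

section minimal
variable {n : ℕ}

/-- Potential function. -/
def pot (u : Fin (n + 2) → FreeGroup (Fin (n + 2))) : ℕ ×ₗ ℕ :=
  toLex (∑ i, (u i).norm, ∑ i, tau (u i))

theorem norm_sgn (u : Fin (n + 2) → FreeGroup (Fin (n + 2))) (s : Fin (n + 2) × Bool) :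
    (sgn u s).norm = (u s.1).norm := by
  rcases s with ⟨i, _ | _⟩ <;> simp [sgn, norm_inv_eq]

theorem tau_sgn (u : Fin (n + 2) → FreeGroup (Fin (n + 2))) (s : Fin (n + 2) × Bool) :
    tau (sgn u s) = tau (u s.1) := by
  rcases s with ⟨i, _ | _⟩ <;> simp [sgn, tau_inv]

theorem sum_update (f : FreeGroup (Fin (n + 2)) → ℕ) (u : Fin (n + 2) → FreeGroup (Fin (n + 2)))
    (i : Fin (n + 2)) (g : FreeGroup (Fin (n + 2))) :
    ∑ k, f (Function.update u i g k) + f (u i) = ∑ k, f (u k) + f g := by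
  have h1 := Finset.add_sum_erase Finset.univ (fun k => f (u k)) (Finset.mem_univ i)
  have h2 := Finset.add_sum_erase Finset.univ (fun k => f (Function.update u i g k))
    (Finset.mem_univ i)
  have h3 : ∑ k ∈ Finset.univ.erase i, f (Function.update u i g k) =
      ∑ k ∈ Finset.univ.erase i, f (u k) := by
    apply Finset.sum_congr rfl
    intro k hk
    rw [Function.update_of_ne (Finset.ne_of_mem_erase hk)]
  simp only [Function.update_self] at h2
  omega

/-- Minimal tuples in their class. -/
def IsMin' (u : Fin (n + 2) → FreeGroup (Fin (n + 2))) : Prop :=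
  ∀ u', Reach u u' → ¬ pot u' < pot u

theorem exists_min (u : Fin (n + 2) → FreeGroup (Fin (n + 2))) :
    ∃ v, Reach u v ∧ IsMin' v := by
  obtain ⟨v, hv, hmin⟩ := (InvImage.wf pot (wellFounded_lt (α := ℕ ×ₗ ℕ))).has_min
    {v | Reach u v} ⟨u, Relation.ReflTransGen.refl⟩
  exact ⟨v, hv, fun u' hu' => hmin u' (Relation.ReflTransGen.trans hv hu')⟩

variable {u : Fin (n + 2) → FreeGroup (Fin (n + 2))}

theorem IsMin'.le (hu : IsMin' u) {s t : Fin (n + 2) × Bool} (h : s.1 ≠ t.1) :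
    (sgn u s).norm ≤ (sgn u t * sgn u s).norm ∧
    ((sgn u t * sgn u s).norm = (sgn u s).norm → tau (sgn u s) ≤ tau (sgn u t * sgn u s)) := by
  obtain ⟨g, hr, hg⟩ := reach_sgn u h
  have hm := hu _ hr
  have e1 : g.norm = (sgn u t * sgn u s).norm := by
    rcases hg with rfl | rfl
    · rfl
    · exact norm_inv_eq
  have e2 : tau g = tau (sgn u t * sgn u s) := by
    rcases hg with rfl | rfl
    · rfl
    · exact tau_inv _
  rw [norm_sgn u s, tau_sgn u s, ← e1, ← e2]
  have s1 := sum_update FreeGroup.norm u s.1 g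
  have s2 := sum_update tau u s.1 g
  unfold pot at hm
  rw [Prod.Lex.toLex_lt_toLex] at hm
  push Not at hm
  simp only at hm
  refine ⟨by omega, fun h => ?_⟩
  have := hm.2 (by omega)
  omega

theorem IsMin'.n1 (hu : IsMin' u) {s t : Fin (n + 2) × Bool} (h : s ≠ t) (ht : sgn u t ≠ 1) :
    2 * gp (sgn u s) (sgn u t) ≤ (sgn u t).norm := by
  by_cases hi : s.1 = t.1
  · rcases eq_or_opp hi with rfl | rfl
    · exact absurd rfl h
    · rw [sgn_opp, gp_comm]
      exact (gp_inv_self ht).le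
  · have h1 := (hu.le (s := s) (t := opp t) hi).1
    have h2 := norm_inv_mul (sgn u t) (sgn u s)
    rw [sgn_opp] at h1
    rw [gp_comm]
    omega

theorem IsMin'.n2_aux (hu : IsMin' u) {t r : Fin (n + 2) × Bool} (hr : r.1 ≠ t.1)
    {h : ℕ} (hh : (sgn u t).norm = 2 * h)
    (hg : gp (sgn u t)⁻¹ (sgn u r) = h) :
    ¬ enc ((sgn u t).toWord.take h) < enc (((sgn u t)⁻¹).toWord.take h) := by
  intro hlt
  have h0 : 2 * h ≤ (sgn u r).norm := by
    have h1 := (hu.le (s := opp t) (t := opp r) (fun h => hr h.symm)).1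
    rw [sgn_opp, sgn_opp] at h1
    have h2 := norm_inv_mul (sgn u r) (sgn u t)⁻¹
    rw [gp_comm, hg] at h2
    omega
  obtain ⟨h1, h2⟩ := tau_lt hh hg h0 hlt
  have := (hu.le hr).2 h1
  omega

theorem IsMin'.n2 (hu : IsMin' u) {s t r : Fin (n + 2) × Bool} (hs : s ≠ t) (hr : opp t ≠ r)
    (ht : sgn u t ≠ 1) :
    gp (sgn u s) (sgn u t) + gp (sgn u (opp t)) (sgn u r) < (sgn u t).norm := by
  have ht' : sgn u (opp t) ≠ 1 := by rw [sgn_opp]; simpa using ht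
  have h1 := hu.n1 hs ht
  have h2 := hu.n1 hr.symm ht'
  rw [gp_comm] at h2
  have hn : (sgn u (opp t)).norm = (sgn u t).norm := by rw [sgn_opp, norm_inv_eq]
  by_contra hcon
  have h3 := gp_inv_self ht
  rw [← sgn_opp] at h3
  have hst : s.1 ≠ t.1 := by
    intro h
    rcases eq_or_opp h with rfl | rfl
    · exact hs rfl
    · have c := gp_comm (sgn u t) (sgn u (opp t))
      omega
  have hrt : r.1 ≠ t.1 := by
    intro h
    rcases eq_or_opp h with rfl | rfl
    · have c := gp_comm (sgn u r) (sgn u (opp r))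
      omega
    · exact hr rfl
  obtain ⟨h, hh⟩ : ∃ h, (sgn u t).norm = 2 * h := ⟨gp (sgn u s) (sgn u t), by omega⟩
  have g1 : gp (sgn u (opp t)) (sgn u r) = h := by omega
  have g2 : gp (sgn u t) (sgn u s) = h := by rw [gp_comm]; omega
  have a1 := hu.n2_aux hrt hh (by rw [← sgn_opp]; exact g1)
  have a2 := hu.n2_aux (t := opp t) (r := s) hst (hn.trans hh)
    (by rw [← sgn_opp, opp_opp]; exact g2)
  rw [← sgn_opp, opp_opp] at a2
  rw [← sgn_opp] at a1
  have l1 : (sgn u t).toWord.length = 2 * h := hh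
  have l2 : (sgn u (opp t)).toWord.length = 2 * h := hn.trans hh
  have e := enc_inj _ _ (by simp [l1, l2]) (le_antisymm (not_lt.1 a2) (not_lt.1 a1))
  have := le_lcp _ _ h e (by omega) (by omega)
  unfold gp at h3
  omega

/-- Admissible words. -/
def Adm (u : Fin (n + 2) → FreeGroup (Fin (n + 2))) (L : List (Fin (n + 2) × Bool)) : Prop :=
  (∀ s ∈ L, sgn u s ≠ 1) ∧ L.IsChain (fun s t => opp s ≠ t)

theorem IsMin'.main (hu : IsMin' u) (L : List (Fin (n + 2) × Bool)) :
    ∀ s, Adm u (s :: L) → ∀ r, r ≠ s →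
      gp (sgn u r) ((s :: L).map (sgn u)).prod = gp (sgn u r) (sgn u s) ∧
      (s :: L).length + gp (sgn u r) (sgn u s) ≤ (((s :: L).map (sgn u)).prod).norm := by
  induction L with
  | nil =>
    intro s hs r hr
    have h0 : sgn u s ≠ 1 := hs.1 s (by simp)
    have h1 := hu.n1 hr h0
    have h2 : (sgn u s).norm ≠ 0 := by rwa [Ne, FreeGroup.norm_eq_zero]
    simp
    omega
  | cons t L ih =>
    intro s hs r hr
    have h0 : sgn u s ≠ 1 := hs.1 s (by simp)
    have hch := List.isChain_cons_cons.1 hs.2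
    obtain ⟨i1, i2⟩ := ih t ⟨fun x hx => hs.1 x (List.mem_cons_of_mem _ hx), hch.2⟩
      (opp s) hch.1
    rw [List.map_cons, List.prod_cons, List.length_cons]
    generalize ((t :: L).map (sgn u)).prod = w at *
    have n2 := hu.n2 hr hch.1 h0
    have e1 := norm_inv_mul (sgn u (opp s)) w
    have e2 := norm_inv_mul (sgn u s * w) (sgn u s)
    have e3 : ((sgn u s * w)⁻¹ * sgn u s) = w⁻¹ := by group
    have e4 : (sgn u (opp s)).norm = (sgn u s).norm := by rw [sgn_opp, norm_inv_eq]
    have e5 : (sgn u (opp s))⁻¹ = sgn u s := by rw [sgn_opp, inv_inv]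
    rw [e3, norm_inv_eq] at e2
    rw [e5, i1, e4] at e1
    have : gp (sgn u r) (sgn u s * w) = gp (sgn u r) (sgn u s) := by
      apply lcp_isosceles
      change gp _ _ < gp _ _
      omega
    refine ⟨this, ?_⟩
    omega

theorem adm_exists (g : FreeGroup (Fin (n + 2))) (hg : g ∈ Subgroup.closure (Set.range u)) :
    ∃ L, Adm u L ∧ (L.map (sgn u)).prod = g := by
  have key : ∀ s L, Adm u L → ∃ L', Adm u L' ∧ (L'.map (sgn u)).prod =
      sgn u s * (L.map (sgn u)).prod := by
    intro s L hL
    by_cases h1 : sgn u s = 1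
    · exact ⟨L, hL, by rw [h1, one_mul]⟩
    cases L with
    | nil => exact ⟨[s], ⟨by simpa using h1, by simp⟩, by simp⟩
    | cons t L =>
      by_cases h2 : opp s = t
      · refine ⟨L, ⟨fun x hx => hL.1 x (List.mem_cons_of_mem _ hx), hL.2.tail⟩, ?_⟩
        rw [← h2]; simp [sgn_opp]
      · refine ⟨s :: t :: L, ⟨?_, List.isChain_cons_cons.2 ⟨h2, hL.2⟩⟩, by simp⟩
        intro x hx
        rcases List.mem_cons.1 hx with rfl | hx
        · exact h1
        · exact hL.1 x hx
  induction hg using Subgroup.closure_induction_left with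
  | one => exact ⟨[], ⟨by simp, by simp⟩, by simp⟩
  | mul_left x hx y _ ih =>
    obtain ⟨i, rfl⟩ := hx
    obtain ⟨L, hL, rfl⟩ := ih
    exact key (i, true) L hL
  | inv_mul_cancel x hx y _ ih =>
    obtain ⟨i, rfl⟩ := hx
    obtain ⟨L, hL, rfl⟩ := ih
    exact key (i, false) L hL

theorem IsMin'.of_eq (hu : IsMin' u) (hgen : Subgroup.closure (Set.range u) = ⊤)
    (i : Fin (n + 2)) : ∃ s, sgn u s = FreeGroup.of i := by
  obtain ⟨L, hL, hp⟩ := adm_exists (u := u) (FreeGroup.of i) (by rw [hgen]; trivial)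
  cases L with
  | nil =>
    have := congrArg FreeGroup.norm hp
    simp at this
  | cons s L =>
    have h := (hu.main L s hL (opp s) (opp_ne s)).2
    rw [hp, norm_of, List.length_cons] at h
    have : L = [] := List.length_eq_zero_iff.1 (by omega)
    subst this
    exact ⟨s, by simpa using hp⟩

theorem reach_of_generates (hgen : Subgroup.closure (Set.range u) = ⊤) :
    Reach (fun i => FreeGroup.of i) u := by
  obtain ⟨v, huv, hv⟩ := exists_min u
  have hgv : Subgroup.closure (Set.range v) = ⊤ :=
    top_le_iff.1 (hgen ▸ closure_reach (reach_symm huv))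
  refine Relation.ReflTransGen.trans ?_ (reach_symm huv)
  choose s hs using hv.of_eq hgv
  have hinj : Function.Injective (fun i => (s i).1) := by
    intro i j hij
    have h1 := hs i
    rcases eq_or_opp hij with h | h
    · rw [h, hs j] at h1
      exact (FreeGroup.of_injective h1).symm
    · rw [h, sgn_opp, hs j] at h1
      have := congrArg FreeGroup.toWord h1
      simp [toWord_inv, invRev] at this
  let π : Equiv.Perm (Fin (n + 2)) := Equiv.ofBijective _ (Finite.injective_iff_bijective.1 hinj)
  apply reach_symm
  have h1 := (reach_perm π v).trans
    (reach_signs (Finset.univ.filter (fun i => (s i).2 = false)) (v ∘ π))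
  convert h1 using 1
  funext i
  rw [← hs i]
  simp only [Finset.mem_filter, Finset.mem_univ, true_and, sgn, Function.comp, π,
    Equiv.ofBijective_apply]
  cases (s i).2 <;> simp

end minimal

section equivs
variable {G : Type*} [Group G] {n : ℕ}

theorem nielsenEquiv_iff (a b : Fin n → G) : NielsenEquiv a b ↔
    ∃ e : FreeGroup (Fin n) ≃* FreeGroup (Fin n),
      ∀ i, FreeGroup.lift a (e (FreeGroup.of i)) = b i := by
  constructor
  · rintro ⟨y, φ, h1, h2⟩
    refine ⟨y.repr.symm, fun i => ?_⟩
    have : φ = FreeGroup.lift a := by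
      ext i; simp [h1]
    rw [← this]
    exact h2 i
  · rintro ⟨e, he⟩
    exact ⟨⟨e.symm⟩, FreeGroup.lift a, by simp, he⟩

theorem nielsenEquiv_refl (a : Fin n → G) : NielsenEquiv a a := by
  rw [nielsenEquiv_iff]
  exact ⟨MulEquiv.refl _, by simp⟩

theorem nielsenEquiv_trans {a b c : Fin n → G} (h1 : NielsenEquiv a b) (h2 : NielsenEquiv b c) :
    NielsenEquiv a c := by
  rw [nielsenEquiv_iff] at *
  obtain ⟨e, he⟩ := h1
  obtain ⟨f, hf⟩ := h2
  refine ⟨f.trans e, fun i => ?_⟩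
  have : (FreeGroup.lift a).comp e.toMonoidHom = FreeGroup.lift b := by
    ext i; simp [he]
  rw [← hf, ← this]
  rfl

theorem nielsenEquiv_of_lifts {a b : Fin n → G} (p q : Fin n → FreeGroup (Fin n))
    (h1 : ∀ i, FreeGroup.lift p (q i) = FreeGroup.of i)
    (h2 : ∀ i, FreeGroup.lift q (p i) = FreeGroup.of i)
    (h : ∀ i, FreeGroup.lift a (p i) = b i) : NielsenEquiv a b := by
  rw [nielsenEquiv_iff]
  refine ⟨MonoidHom.toMulEquiv (FreeGroup.lift p) (FreeGroup.lift q) ?_ ?_, ?_⟩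
  · ext i; simp [h2]
  · ext i; simp [h1]
  · intro i; simp [h]

theorem nielsenEquiv_step {a b : Fin (n + 2) → G} (h : ElementaryNielsenStep a b) :
    NielsenEquiv a b := by
  rcases h with rfl | rfl | rfl | rfl
  · refine nielsenEquiv_of_lifts (fun i => of (Equiv.swap 0 1 i)) (fun i => of (Equiv.swap 0 1 i))
      ?_ ?_ ?_ <;> simp
  · refine nielsenEquiv_of_lifts (fun i => of (i + 1)) (fun i => of (i - 1)) ?_ ?_ ?_ <;> simp
  · refine nielsenEquiv_of_lifts (Function.update of 0 (of 0)⁻¹) (Function.update of 0 (of 0)⁻¹)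
      ?_ ?_ ?_ <;>
    · intro i
      by_cases hi : i = 0
      · subst hi; simp
      · simp [hi]
  · refine nielsenEquiv_of_lifts (Function.update of 0 (of 0 * of 1))
      (Function.update of 0 (of 0 * (of 1)⁻¹)) ?_ ?_ ?_ <;>
    · intro i
      by_cases hi : i = 0
      · subst hi; simp
      · simp [hi]

end equivs

end NielsenAux

/-- Nielsen's reformulation: two generating tuples (of length `n + 2`, i.e. of length at least
two) are Nielsen equivalent if and only if one is obtained from the other by a finite sequence
of elementary Nielsen transformations. -/
theorem nielsenEquiv_iff_reflTransGen_elementarySteps {G : Type*} [Group G] {n : ℕ}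
    (a b : Fin (n + 2) → G) (ha : IsGeneratingTuple a) (hb : IsGeneratingTuple b) :
    NielsenEquiv a b ↔ Relation.ReflTransGen ElementaryNielsenStep a b := by
  constructor
  · intro h
    obtain ⟨e, he⟩ := (NielsenAux.nielsenEquiv_iff a b).1 h
    have hgen : Subgroup.closure (Set.range (fun i => e (FreeGroup.of i))) = ⊤ := by
      have h1 := congrArg (Subgroup.map e.toMonoidHom) (FreeGroup.closure_range_of (Fin (n + 2)))
      rw [MonoidHom.map_closure, ← Set.range_comp,
        Subgroup.map_top_of_surjective _ e.surjective] at h1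
      exact h1
    have h2 := NielsenAux.reach_map (FreeGroup.lift a) (NielsenAux.reach_of_generates hgen)
    convert h2 using 1
    · funext i; simp
    · funext i; exact (he i).symm
  · intro h
    clear hb
    induction h with
    | refl => exact NielsenAux.nielsenEquiv_refl a
    | tail _ h ih =>
      exact NielsenAux.nielsenEquiv_trans ih (NielsenAux.nielsenEquiv_step h)
end

section
/- Let G be a group, n a positive integer, a a generating n-tuple of G, and g ∈ G. Then the conjugated tuple (g · (a 0) · g⁻¹, …, g · (a (n−1)) · g⁻¹) is a generating n-tuple of G that is Nielsen equivalent to a. (This makes the Nielsen class associated to a spine independent of the choice of connecting path.) -/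
/-- Conjugating every entry of a generating `n`-tuple by a fixed element `g` yields a
generating `n`-tuple which is Nielsen equivalent to the original one. -/
theorem nielsenEquiv_conjugate {G : Type*} [Group G] {n : ℕ} (hn : 0 < n)
    (a : Fin n → G) (ha : IsGeneratingTuple a) (g : G) :
    IsGeneratingTuple (fun i => g * a i * g⁻¹) ∧
      NielsenEquiv a (fun i => g * a i * g⁻¹) := by
  constructor
  · have hr : Set.range (fun i => g * a i * g⁻¹) =
        Set.image (MulAut.conj g).toMonoidHom (Set.range a) := by
      rw [← Set.range_comp]
      rfl
    unfold IsGeneratingTuple at *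
    rw [hr, ← MonoidHom.map_closure, ha]
    exact Subgroup.map_top_of_surjective _ (MulAut.conj g).surjective
  · have hs : g ∈ (FreeGroup.lift a).range := by
      rw [FreeGroup.range_lift_eq_closure, show Subgroup.closure (Set.range a) = ⊤ from ha]
      trivial
    obtain ⟨w, hw⟩ := hs
    refine ⟨(FreeGroupBasis.ofFreeGroup (Fin n)).map (MulAut.conj w), FreeGroup.lift a, ?_, ?_⟩
    · intro i
      simp
    · intro i
      simp [hw]
end

section
/- Let α be a type and R a set of elements of the free group FreeGroup α. Let ι₁, ι₂ : FreeGroup α →* FreeGroup (α ⊕ α) be the homomorphisms induced by Sum.inl and Sum.inr, and let D = { FreeGroup.of (Sum.inl a) * (FreeGroup.of (Sum.inr a))⁻¹ : a ∈ α }. Then the presented group PresentedGroup (ι₁ '' R ∪ ι₂ '' R ∪ D) on the generating set α ⊕ α is isomorphic to PresentedGroup R, via the isomorphism sending the classes of both Sum.inl a and Sum.inr a to the class of a. (This is the group-theoretic content of the Van Kampen computation showing that doubling the generating set of a presentation along identified generators does not change the group, as in the computation of π₁ of the double of M° × I.) -/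
/-- Doubling the generating set of a presentation, imposing the relators on both copies and
identifying corresponding generators, does not change the presented group: the canonical
isomorphism sends the classes of both `Sum.inl a` and `Sum.inr a` to the class of `a`. -/
theorem presentedGroup_double {α : Type*} (R : Set (FreeGroup α))
    (ι₁ ι₂ : FreeGroup α →* FreeGroup (α ⊕ α))
    (hι₁ : ι₁ = FreeGroup.map Sum.inl) (hι₂ : ι₂ = FreeGroup.map Sum.inr)
    (D : Set (FreeGroup (α ⊕ α)))
    (hD : D = Set.range fun a : α =>
      FreeGroup.of (Sum.inl a) * (FreeGroup.of (Sum.inr a))⁻¹) :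
    ∃ e : PresentedGroup (⇑ι₁ '' R ∪ ⇑ι₂ '' R ∪ D) ≃* PresentedGroup R,
      ∀ a : α,
        e (PresentedGroup.of (Sum.inl a)) = PresentedGroup.of a ∧
        e (PresentedGroup.of (Sum.inr a)) = PresentedGroup.of a := by
  subst hι₁ hι₂
  have hS : ∀ r ∈ (FreeGroup.map Sum.inl '' R ∪ FreeGroup.map Sum.inr '' R ∪ D :
      Set (FreeGroup (α ⊕ α))),
      FreeGroup.lift (Sum.elim (PresentedGroup.of (rels := R)) PresentedGroup.of) r = 1 := by
    rintro _ ((⟨r, hr, rfl⟩ | ⟨r, hr, rfl⟩) | h)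
    · have h : (FreeGroup.lift (Sum.elim (PresentedGroup.of (rels := R)) PresentedGroup.of)).comp
          (FreeGroup.map Sum.inl) = PresentedGroup.mk R := FreeGroup.ext_hom _ _ fun _ => rfl
      exact (DFunLike.congr_fun h r).trans (PresentedGroup.one_of_mem hr)
    · have h : (FreeGroup.lift (Sum.elim (PresentedGroup.of (rels := R)) PresentedGroup.of)).comp
          (FreeGroup.map Sum.inr) = PresentedGroup.mk R := FreeGroup.ext_hom _ _ fun _ => rfl
      exact (DFunLike.congr_fun h r).trans (PresentedGroup.one_of_mem hr)
    · rw [hD] at h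
      obtain ⟨a, rfl⟩ := h
      simp
  have hT : ∀ r ∈ R, FreeGroup.lift (fun a : α => PresentedGroup.of
      (rels := FreeGroup.map Sum.inl '' R ∪ FreeGroup.map Sum.inr '' R ∪ D) (Sum.inl a)) r = 1 := by
    intro r hr
    have h : FreeGroup.lift (fun a : α => PresentedGroup.of
        (rels := FreeGroup.map Sum.inl '' R ∪ FreeGroup.map Sum.inr '' R ∪ D) (Sum.inl a)) =
        (PresentedGroup.mk _).comp (FreeGroup.map Sum.inl) :=
      FreeGroup.ext_hom _ _ fun a => by simp [PresentedGroup.of]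
    rw [h]
    exact PresentedGroup.one_of_mem (Or.inl (Or.inl ⟨r, hr, rfl⟩))
  refine ⟨MonoidHom.toMulEquiv (PresentedGroup.toGroup hS) (PresentedGroup.toGroup hT) ?_ ?_, ?_⟩
  · apply PresentedGroup.ext
    rintro (a | a)
    · simp
    · simp only [MonoidHom.comp_apply, PresentedGroup.toGroup.of, Sum.elim_inr, MonoidHom.id_apply]
      exact PresentedGroup.mk_eq_mk_of_mul_inv_mem (Or.inr (hD ▸ ⟨a, rfl⟩))
  · apply PresentedGroup.ext
    intro a
    simp
  · intro a
    simp
end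

section
/- Let α and β be types, R a set of elements of FreeGroup α, and w : β → FreeGroup α an arbitrary function. Let ι : FreeGroup α →* FreeGroup (α ⊕ β) be induced by Sum.inl, and let D = { FreeGroup.of (Sum.inr b) * (ι (w b))⁻¹ : b ∈ β }. Then PresentedGroup (ι '' R ∪ D) is isomorphic to PresentedGroup R, via the isomorphism sending the class of Sum.inl a to the class of a and the class of Sum.inr b to the class of w b. (Adding generators together with defining relations does not change a presented group; this underlies adding the meridian curves of the extra handlebody sectors without changing the 4-manifold's fundamental group.) -/
/-- Adding new generators `b : β` together with defining relators `b = w b` (for arbitrary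
words `w b` in the old generators) does not change a presented group: the canonical
isomorphism sends the class of `Sum.inl a` to the class of `a` and the class of `Sum.inr b`
to the class of the word `w b`. -/
theorem presentedGroup_add_generators {α β : Type*} (R : Set (FreeGroup α))
    (w : β → FreeGroup α) (ι : FreeGroup α →* FreeGroup (α ⊕ β))
    (hι : ι = FreeGroup.map Sum.inl) (D : Set (FreeGroup (α ⊕ β)))
    (hD : D = Set.range fun b : β => FreeGroup.of (Sum.inr b) * (ι (w b))⁻¹) :
    ∃ e : PresentedGroup (⇑ι '' R ∪ D) ≃* PresentedGroup R,
      (∀ a : α, e (PresentedGroup.of (Sum.inl a)) = PresentedGroup.of a) ∧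
      (∀ b : β, e (PresentedGroup.of (Sum.inr b)) = PresentedGroup.mk R (w b)) := by
  have key : (FreeGroup.lift (Sum.elim (fun a => (PresentedGroup.of a : PresentedGroup R))
      (fun b => PresentedGroup.mk R (w b)))).comp ι = PresentedGroup.mk R := by
    subst hι
    exact FreeGroup.ext_hom _ _ fun _ => rfl
  have h : ∀ r ∈ ⇑ι '' R ∪ D,
      FreeGroup.lift (Sum.elim (fun a => (PresentedGroup.of a : PresentedGroup R))
        (fun b => PresentedGroup.mk R (w b))) r = 1 := by
    rintro r (⟨r, hr, rfl⟩ | hr)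
    · rw [← MonoidHom.comp_apply, key, PresentedGroup.one_of_mem hr]
    · rw [hD] at hr
      obtain ⟨b, rfl⟩ := hr
      have hb := DFunLike.congr_fun key (w b)
      rw [MonoidHom.comp_apply] at hb
      simp only [map_mul, map_inv, hb, FreeGroup.lift_apply_of, Sum.elim_inr, mul_inv_cancel]
  let f : PresentedGroup (⇑ι '' R ∪ D) →* PresentedGroup R := PresentedGroup.toGroup h
  let g : PresentedGroup R →* PresentedGroup (⇑ι '' R ∪ D) :=
    PresentedGroup.map ι (fun r hr => Or.inl ⟨r, hr, rfl⟩)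
  have hg : ∀ x, g (PresentedGroup.mk R x) = PresentedGroup.mk _ (ι x) := fun _ => rfl
  have hga : ∀ a : α, g (PresentedGroup.of a) = PresentedGroup.of (Sum.inl a) := by
    intro a
    refine (hg _).trans ?_
    rw [hι]
    rfl
  have hfl : ∀ a : α, f (PresentedGroup.of (Sum.inl a)) = PresentedGroup.of a :=
    fun a => PresentedGroup.toGroup.of h
  have hfr : ∀ b : β, f (PresentedGroup.of (Sum.inr b)) = PresentedGroup.mk R (w b) :=
    fun b => PresentedGroup.toGroup.of h
  refine ⟨MonoidHom.toMulEquiv f g ?_ ?_, hfl, hfr⟩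
  · apply PresentedGroup.ext
    rintro (a | b)
    · rw [MonoidHom.comp_apply, hfl, hga, MonoidHom.id_apply]
    · rw [MonoidHom.comp_apply, hfr, hg, MonoidHom.id_apply]
      refine (PresentedGroup.mk_eq_mk_of_mul_inv_mem (Or.inr ?_)).symm
      rw [hD]
      exact ⟨b, rfl⟩
  · apply PresentedGroup.ext
    intro a
    rw [MonoidHom.comp_apply, hga, hfl, MonoidHom.id_apply]
end

section
/- Let α be a type, R a set of elements of FreeGroup α, and m a positive integer. On the generating set α × Fin m, consider the relator set consisting of, for each j ∈ Fin m, the image of R under the homomorphism FreeGroup α →* FreeGroup (α × Fin m) induced by a ↦ (a, j), together with the identification relators FreeGroup.of (a, j) * (FreeGroup.of (a, j+1))⁻¹ for every a ∈ α and every j with j + 1 < m. Then the resulting presented group is isomorphic to PresentedGroup R, via the isomorphism sending the class of (a, j) to the class of a for every j. (This is the group-theoretic content of Lemma computing π₁(X₁ ∪_{H} X₂ ∪_{H} ⋯ ∪_{H} X_m) ≅ π₁(Xᵢ) for m copies of the bisection glued consecutively along handlebodies inducing the same generating set.) -/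
/-- Taking `m` copies of a presentation `⟨α ∣ R⟩` on the generating set `α × Fin m`, imposing
the relators `R` on each copy and identifying the generators of consecutive copies, presents
the same group: the canonical isomorphism sends the class of `(a, j)` to the class of `a` for
every `j`. -/
theorem presentedGroup_consecutive_copies {α : Type*} (R : Set (FreeGroup α))
    (m : ℕ) (hm : 0 < m)
    (D : Set (FreeGroup (α × Fin m)))
    (hD : D = {x | ∃ (a : α) (j : ℕ) (h : j + 1 < m),
      x = FreeGroup.of (a, (⟨j, Nat.lt_of_succ_lt h⟩ : Fin m)) *
        (FreeGroup.of (a, (⟨j + 1, h⟩ : Fin m)))⁻¹}) :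
    ∃ e : PresentedGroup
        ((⋃ j : Fin m, ⇑(FreeGroup.map (fun a : α => (a, j))) '' R) ∪ D) ≃*
        PresentedGroup R,
      ∀ (a : α) (j : Fin m), e (PresentedGroup.of (a, j)) = PresentedGroup.of a := by
  set S := (⋃ j : Fin m, ⇑(FreeGroup.map (fun a : α => (a, j))) '' R) ∪ D with hS
  have h1 : ∀ r ∈ S, FreeGroup.lift
      (fun p : α × Fin m => (PresentedGroup.of p.1 : PresentedGroup R)) r = 1 := by
    intro r hr
    rcases hr with hr | hr
    · obtain ⟨j, x, hx, rfl⟩ := Set.mem_iUnion.1 hr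
      have key : (FreeGroup.lift
          (fun p : α × Fin m => (PresentedGroup.of p.1 : PresentedGroup R))).comp
          (FreeGroup.map (fun a : α => (a, j))) = PresentedGroup.mk R := by
        ext a
        simp [PresentedGroup.of]
      have := DFunLike.congr_fun key x
      rw [MonoidHom.comp_apply] at this
      rw [this]
      exact PresentedGroup.one_of_mem hx
    · rw [hD] at hr
      obtain ⟨a, j, h, rfl⟩ := hr
      simp
  have h2 : ∀ r ∈ R, FreeGroup.lift
      (fun a : α => (PresentedGroup.of (a, (⟨0, hm⟩ : Fin m)) : PresentedGroup S)) r = 1 := by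
    intro r hr
    have key : FreeGroup.lift
        (fun a : α => (PresentedGroup.of (a, (⟨0, hm⟩ : Fin m)) : PresentedGroup S)) =
        (PresentedGroup.mk S).comp (FreeGroup.map (fun a : α => (a, (⟨0, hm⟩ : Fin m)))) := by
      ext a
      simp [PresentedGroup.of]
    rw [key, MonoidHom.comp_apply]
    exact PresentedGroup.one_of_mem (Or.inl (Set.mem_iUnion.2 ⟨⟨0, hm⟩, r, hr, rfl⟩))
  have h3 : ∀ (a : α) (j : ℕ) (hj : j < m),
      (PresentedGroup.of (a, (⟨0, hm⟩ : Fin m)) : PresentedGroup S) =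
        PresentedGroup.of (a, (⟨j, hj⟩ : Fin m)) := by
    intro a j
    induction j with
    | zero => intro _; rfl
    | succ k ih =>
      intro hj
      rw [ih (Nat.lt_of_succ_lt hj)]
      apply PresentedGroup.mk_eq_mk_of_mul_inv_mem
      right
      rw [hD]
      exact ⟨a, k, hj, rfl⟩
  refine ⟨MonoidHom.toMulEquiv (PresentedGroup.toGroup h1) (PresentedGroup.toGroup h2) ?_ ?_, ?_⟩
  · apply PresentedGroup.ext
    rintro ⟨a, j, hj⟩
    simp only [MonoidHom.comp_apply, PresentedGroup.toGroup.of, MonoidHom.id_apply]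
    exact h3 a j hj
  · apply PresentedGroup.ext
    intro a
    simp only [MonoidHom.comp_apply, PresentedGroup.toGroup.of, MonoidHom.id_apply]
  · intro a j
    exact PresentedGroup.toGroup.of h1
end
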